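/- For all messages m m' : M and all groups g h : G with g ∈ P m ∩ P m' and h ∈ P m ∩ P m' (g and h not necessarily comparable under anc), one has: ord g m m' holds iff ord h m m' holds. That is, all groups that order both messages agree on their relative order. -/

import Mathlib

/-- The ancestor relation: `a` is an ancestor of `b` iff some iterate of the
parent function maps `b` to `a`. -/
def anc {G : Type*} (p : G → G) (a b : G) : Prop := ∃ k : ℕ, p^[k] b = a

/-- The ordering path of a message `m`: the groups lying on a downward path
from the least common ancestor `L m` to some destination of `m`. -/
def orderPath {G M : Type*} (p : G → G) (D : M → Set G) (L : M → G) (m : M) : Set G :=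
  {g : G | anc p (L m) g ∧ ∃ x ∈ D m, anc p g x}

theorem anc.trans {G : Type*} {p : G → G} {a b c : G} (hab : anc p a b) (hbc : anc p b c) :
    anc p a c := by
  obtain ⟨k, rfl⟩ := hab
  obtain ⟨l, rfl⟩ := hbc
  exact ⟨k + l, Function.iterate_add_apply p k l c⟩

/-- Two ancestors of the same group are comparable. -/
theorem anc.total {G : Type*} {p : G → G} {a b c : G} (hac : anc p a c) (hbc : anc p b c) :
    anc p a b ∨ anc p b a := by
  obtain ⟨k, rfl⟩ := hac
  obtain ⟨l, rfl⟩ := hbc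
  rcases le_total k l with hkl | hlk
  · exact .inr ⟨l - k, by rw [← Function.iterate_add_apply, Nat.sub_add_cancel hkl]⟩
  · exact .inl ⟨k - l, by rw [← Function.iterate_add_apply, Nat.sub_add_cancel hlk]⟩

/-- An ancestor of a group on the ordering path that descends from the least common ancestor
is itself on the ordering path. -/
theorem mem_orderPath_of_anc {G M : Type*} {p : G → G} {D : M → Set G} {L : M → G} {m : M}
    {a b : G} (hb : b ∈ orderPath p D L m) (hLa : anc p (L m) a) (hab : anc p a b) :
    a ∈ orderPath p D L m :=
  let ⟨x, hx, hbx⟩ := hb.2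
  ⟨hLa, x, hx, hab.trans hbx⟩

/-- Comparable groups that order both messages agree on their relative order. -/
theorem ord_iff_of_anc {G M : Type*} {p : G → G} {D : M → Set G} {L : M → G}
    {ord : G → M → M → Prop}
    (hloc : ∀ g h : G, p h = g → ∀ m m' : M,
      g ∈ orderPath p D L m ∩ orderPath p D L m' →
      h ∈ orderPath p D L m ∩ orderPath p D L m' →
      (ord g m m' ↔ ord h m m'))
    {m m' : M} {a b : G} (hab : anc p a b)
    (ha : a ∈ orderPath p D L m ∩ orderPath p D L m')
    (hb : b ∈ orderPath p D L m ∩ orderPath p D L m') :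
    ord a m m' ↔ ord b m m' := by
  obtain ⟨k, hk⟩ := hab
  induction k generalizing b with
  | zero => exact hk ▸ Iff.rfl
  | succ k ih =>
    have hk' : p^[k] (p b) = a := hk
    have hap : anc p a (p b) := ⟨k, hk'⟩
    have hpb : anc p (p b) b := ⟨1, rfl⟩
    have hmem : p b ∈ orderPath p D L m ∩ orderPath p D L m' :=
      ⟨mem_orderPath_of_anc hb.1 (ha.1.1.trans hap) hpb,
        mem_orderPath_of_anc hb.2 (ha.2.1.trans hap) hpb⟩
    exact (ih hmem hk').trans (hloc _ _ rfl m m' hmem hb)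

/-- All groups that order both messages agree on their relative order, even if
the two groups are not comparable under the ancestor relation. -/
theorem ord_eq_of_mem_paths {G M : Type*} (p : G → G)
    (D : M → Set G) (L : M → G)
    (hL : ∀ m : M, ∀ g ∈ D m, anc p (L m) g)
    (ord : G → M → M → Prop)
    (hirr : ∀ g : G, ∀ m : M, ¬ ord g m m)
    (htrans : ∀ g : G, ∀ m₁ m₂ m₃ : M, ord g m₁ m₂ → ord g m₂ m₃ → ord g m₁ m₃)
    (hloc : ∀ g h : G, p h = g → ∀ m m' : M,
      g ∈ orderPath p D L m ∩ orderPath p D L m' →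
      h ∈ orderPath p D L m ∩ orderPath p D L m' →
      (ord g m m' ↔ ord h m m'))
    (m m' : M) (g h : G)
    (hg : g ∈ orderPath p D L m ∩ orderPath p D L m')
    (hh : h ∈ orderPath p D L m ∩ orderPath p D L m') :
    (ord g m m' ↔ ord h m m') := by
  obtain ⟨c, hLc, hLc', hcg, hch⟩ :
      ∃ c, anc p (L m) c ∧ anc p (L m') c ∧ anc p c g ∧ anc p c h := by
    rcases hg.1.1.total hg.2.1 with hLL | hLL
    · exact ⟨L m', hLL, ⟨0, rfl⟩, hg.2.1, hh.2.1⟩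
    · exact ⟨L m, ⟨0, rfl⟩, hLL, hg.1.1, hh.1.1⟩
  have hc : c ∈ orderPath p D L m ∩ orderPath p D L m' :=
    ⟨mem_orderPath_of_anc hg.1 hLc hcg, mem_orderPath_of_anc hg.2 hLc' hcg⟩
  exact (ord_iff_of_anc hloc hcg hc hg).symm.trans (ord_iff_of_anc hloc hch hc hh)
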